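/- arXiv:math/0503377 — 3 statements merged into one kernel-verified Lean document; each statement's English description precedes it below -/
import Mathlib

section
/- For every real number x one has C'(x) = S(x)/2; for every real x \neq 0 one has S'(x) = (C(x) - S(x))/(2x); and the derivative S' is strictly increasing on the interval (-\pi^2, \infty). -/
open Real

/-- `C x = ∑ xⁿ/(2n)!`, i.e. `cosh √x` for `x ≥ 0` and `cos √(-x)` for `x ≤ 0`. -/
noncomputable def C (x : ℝ) : ℝ := ∑' n : ℕ, x ^ n / (Nat.factorial (2 * n))

/-- `S x = ∑ xⁿ/(2n+1)!`, i.e. `sinh √x/√x` for `x > 0` and `sin √(-x)/√(-x)` for `x < 0`. -/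
noncomputable def S (x : ℝ) : ℝ := ∑' n : ℕ, x ^ n / (Nat.factorial (2 * n + 1))

/-- The power series with coefficients `a`. -/
noncomputable def powerSum (a : ℕ → ℝ) (x : ℝ) : ℝ := ∑' n : ℕ, a n * x ^ n

/-- The coefficients of the formal derivative. -/
def derivCoeff (a : ℕ → ℝ) (n : ℕ) : ℝ := (n + 1) * a (n + 1)

/-- The coefficients are dominated by those of the exponential series. -/
def ExpBounded (a : ℕ → ℝ) : Prop := ∀ n, |a n| ≤ 1 / (Nat.factorial n : ℝ)

theorem ExpBounded.derivCoeff {a : ℕ → ℝ} (ha : ExpBounded a) : ExpBounded (derivCoeff a) := by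
  intro n
  have h := ha (n + 1)
  have hn : (0 : ℝ) < n + 1 := by positivity
  rw [_root_.derivCoeff, abs_mul, abs_of_pos hn]
  calc ((n : ℝ) + 1) * |a (n + 1)| ≤ (n + 1) * (1 / (Nat.factorial (n + 1) : ℝ)) := by gcongr
    _ = 1 / (Nat.factorial n : ℝ) := by
      rw [Nat.factorial_succ]
      push_cast
      field_simp

theorem ExpBounded.norm_mul_pow_le {a : ℕ → ℝ} (ha : ExpBounded a) {x R : ℝ} (hx : |x| ≤ R)
    (n : ℕ) : ‖a n * x ^ n‖ ≤ R ^ n / (Nat.factorial n : ℝ) := by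
  rw [Real.norm_eq_abs, abs_mul, abs_pow, div_eq_inv_mul, ← one_div]
  gcongr
  exact ha n

theorem ExpBounded.summable {a : ℕ → ℝ} (ha : ExpBounded a) (x : ℝ) :
    Summable fun n => a n * x ^ n :=
  Summable.of_norm_bounded (Real.summable_pow_div_factorial |x|) (ha.norm_mul_pow_le le_rfl)

theorem ExpBounded.hasDerivAt {a : ℕ → ℝ} (ha : ExpBounded a) (x : ℝ) :
    HasDerivAt (powerSum a) (powerSum (_root_.derivCoeff a) x) x := by
  have hsplit : ∀ y, powerSum a y = a 0 + ∑' n : ℕ, a (n + 1) * y ^ (n + 1) := by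
    intro y
    rw [powerSum, (ha.summable y).tsum_eq_zero_add]
    simp
  have key : HasDerivAt (fun y => ∑' n : ℕ, a (n + 1) * y ^ (n + 1))
      (∑' n : ℕ, _root_.derivCoeff a n * x ^ n) x := by
    refine hasDerivAt_tsum_of_isPreconnected (t := Metric.ball 0 (|x| + 1)) (y₀ := x)
      (g' := fun n y => _root_.derivCoeff a n * y ^ n)
      (Real.summable_pow_div_factorial (|x| + 1))
      Metric.isOpen_ball (convex_ball _ _).isPreconnected ?_ ?_ ?_ ?_ ?_
    · intro n y _
      refine ((hasDerivAt_pow (n + 1) y).const_mul (a (n + 1))).congr_deriv ?_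
      simp only [_root_.derivCoeff, Nat.add_sub_cancel]
      push_cast
      ring
    · intro n y hy
      rw [mem_ball_zero_iff, Real.norm_eq_abs] at hy
      exact ha.derivCoeff.norm_mul_pow_le hy.le n
    · simp
    · exact (summable_nat_add_iff 1).2 (ha.summable x)
    · simp
  rw [funext hsplit]
  exact key.const_add _

/-- A power series with positive coefficients is positive on `[0, ∞)`. -/
theorem ExpBounded.powerSum_pos {a : ℕ → ℝ} (ha : ExpBounded a) (hpos : ∀ n, 0 < a n) {x : ℝ}
    (hx : 0 ≤ x) : 0 < powerSum a x :=
  (ha.summable x).tsum_pos (fun n => mul_nonneg (hpos n).le (pow_nonneg hx n)) 0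
    (by simpa using hpos 0)

theorem derivCoeff_pos {a : ℕ → ℝ} (hpos : ∀ n, 0 < a n) (n : ℕ) : 0 < derivCoeff a n :=
  mul_pos (by positivity) (hpos _)

/-- The Taylor coefficients of `C`. -/
noncomputable def coeffC (n : ℕ) : ℝ := 1 / (Nat.factorial (2 * n) : ℝ)

/-- The Taylor coefficients of `S`. -/
noncomputable def coeffS (n : ℕ) : ℝ := 1 / (Nat.factorial (2 * n + 1) : ℝ)

theorem coeffS_pos (n : ℕ) : 0 < coeffS n := by unfold coeffS; positivity

theorem expBounded_one_div_factorial {f : ℕ → ℕ} (hf : ∀ n, n ≤ f n) :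
    ExpBounded fun n => 1 / (Nat.factorial (f n) : ℝ) := by
  intro n
  rw [abs_of_pos (by positivity)]
  exact one_div_le_one_div_of_le (by positivity) (by exact_mod_cast Nat.factorial_le (hf n))

theorem expBounded_coeffC : ExpBounded coeffC :=
  expBounded_one_div_factorial fun n => by omega

theorem expBounded_coeffS : ExpBounded coeffS :=
  expBounded_one_div_factorial fun n => by omega

theorem C_eq_powerSum : C = powerSum coeffC := by
  funext x
  simp only [C, powerSum, coeffC, one_div_mul_eq_div]

theorem S_eq_powerSum : S = powerSum coeffS := by
  funext x
  simp only [S, powerSum, coeffS, one_div_mul_eq_div]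

theorem derivCoeff_coeffC (n : ℕ) : derivCoeff coeffC n = coeffS n / 2 := by
  simp only [derivCoeff, coeffC, coeffS, show 2 * (n + 1) = 2 * n + 1 + 1 by ring,
    Nat.factorial_succ (2 * n + 1)]
  push_cast
  field_simp
  ring

theorem coeffC_sub_coeffS (n : ℕ) :
    coeffC (n + 1) - coeffS (n + 1) = 2 * derivCoeff coeffS n := by
  simp only [derivCoeff, coeffC, coeffS, Nat.factorial_succ (2 * (n + 1))]
  push_cast
  field_simp
  ring

theorem hasDerivAt_C (x : ℝ) : HasDerivAt C (S x / 2) x := by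
  have h := expBounded_coeffC.hasDerivAt x
  rw [← C_eq_powerSum] at h
  refine h.congr_deriv ?_
  rw [S_eq_powerSum]
  simp only [powerSum, derivCoeff_coeffC, ← tsum_div_const]
  exact tsum_congr fun n => by ring

theorem hasDerivAt_S (x : ℝ) : HasDerivAt S (powerSum (derivCoeff coeffS) x) x := by
  rw [S_eq_powerSum]
  exact expBounded_coeffS.hasDerivAt x

theorem deriv_S : deriv S = powerSum (derivCoeff coeffS) :=
  funext fun x => (hasDerivAt_S x).deriv

theorem hasDerivAt_deriv_S (x : ℝ) :
    HasDerivAt (deriv S) (powerSum (derivCoeff (derivCoeff coeffS)) x) x := by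
  rw [deriv_S]
  exact expBounded_coeffS.derivCoeff.hasDerivAt x

theorem two_mul_deriv_S (x : ℝ) : 2 * x * deriv S x = C x - S x := by
  have hC := expBounded_coeffC.summable x
  have hS := expBounded_coeffS.summable x
  rw [deriv_S, C_eq_powerSum, S_eq_powerSum]
  simp only [powerSum]
  rw [← hC.tsum_sub hS, (hC.sub hS).tsum_eq_zero_add, ← tsum_mul_left]
  have h0 : coeffC 0 * x ^ 0 - coeffS 0 * x ^ 0 = 0 := by simp [coeffC, coeffS]
  rw [h0, zero_add]
  refine tsum_congr fun n => ?_
  rw [← sub_mul, coeffC_sub_coeffS]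
  ring

theorem two_mul_deriv_deriv_S (x : ℝ) :
    2 * x * powerSum (derivCoeff (derivCoeff coeffS)) x = S x / 2 - 3 * deriv S x := by
  have h1 := ((hasDerivAt_id x).const_mul 2).mul (hasDerivAt_deriv_S x)
  have h2 := (hasDerivAt_C x).sub (hasDerivAt_S x)
  have he : ((fun y : ℝ => 2 * id y) * deriv S) = C - S := by
    funext y
    simpa using two_mul_deriv_S y
  rw [he] at h1
  have h := h1.unique h2
  rw [← (hasDerivAt_S x).deriv] at h
  simp only [id] at h
  linarith

theorem C_neg_sq (y : ℝ) : C (-y ^ 2) = cos y := by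
  rw [C, ← (Real.hasSum_cos y).tsum_eq]
  refine tsum_congr fun n => ?_
  rw [neg_pow, ← pow_mul]

theorem mul_S_neg_sq (y : ℝ) : y * S (-y ^ 2) = sin y := by
  rw [S, ← (Real.hasSum_sin y).tsum_eq, ← tsum_mul_left]
  refine tsum_congr fun n => ?_
  rw [neg_pow, ← pow_mul, pow_succ]
  ring

theorem pos_of_hasDerivAt_pos {f f' : ℝ → ℝ} {b : ℝ} (hf : ∀ y, HasDerivAt f (f' y) y)
    (h0 : f 0 = 0) (hf' : ∀ y ∈ Set.Ioo 0 b, 0 < f' y) {y : ℝ} (hy : y ∈ Set.Ioo 0 b) :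
    0 < f y := by
  have hmono : StrictMonoOn f (Set.Ico 0 b) := by
    refine strictMonoOn_of_deriv_pos (convex_Ico 0 b)
      (fun z _ => (hf z).continuousAt.continuousWithinAt) fun z hz => ?_
    rw [interior_Ico] at hz
    rw [(hf z).deriv]
    exact hf' z hz
  rw [← h0]
  exact hmono ⟨le_rfl, hy.1.trans hy.2⟩ ⟨hy.1.le, hy.2⟩ hy.1

theorem sin_sub_mul_cos_pos {y : ℝ} (hy : y ∈ Set.Ioo 0 π) : 0 < sin y - y * cos y := by
  refine pos_of_hasDerivAt_pos (f := fun z => sin z - z * cos z) (f' := fun z => z * sin z)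
    (fun z => ?_) (by simp) (fun z hz => mul_pos hz.1 (sin_pos_of_mem_Ioo hz)) hy
  refine ((hasDerivAt_sin z).sub ((hasDerivAt_id z).mul (hasDerivAt_cos z))).congr_deriv ?_
  simp only [id]
  ring

theorem three_mul_sin_sub_pos {y : ℝ} (hy : y ∈ Set.Ioo 0 π) :
    0 < 3 * (sin y - y * cos y) - y ^ 2 * sin y := by
  refine pos_of_hasDerivAt_pos (f := fun z => 3 * (sin z - z * cos z) - z ^ 2 * sin z)
    (f' := fun z => z * (sin z - z * cos z))
    (fun z => ?_) (by simp) (fun z hz => mul_pos hz.1 (sin_sub_mul_cos_pos hz)) hy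
  refine ((((hasDerivAt_sin z).sub ((hasDerivAt_id z).mul (hasDerivAt_cos z))).const_mul 3).sub
    ((hasDerivAt_pow 2 z).mul (hasDerivAt_sin z))).congr_deriv ?_
  simp only [id]
  push_cast
  ring

theorem deriv_deriv_S_pos {x : ℝ} (hx : -π ^ 2 < x) :
    0 < powerSum (derivCoeff (derivCoeff coeffS)) x := by
  rcases le_or_gt 0 x with h | h
  · exact expBounded_coeffS.derivCoeff.derivCoeff.powerSum_pos
      (derivCoeff_pos (derivCoeff_pos coeffS_pos)) h
  · obtain ⟨y, hy0, rfl⟩ : ∃ y : ℝ, 0 < y ∧ x = -y ^ 2 :=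
      ⟨√(-x), Real.sqrt_pos.2 (by linarith), by rw [Real.sq_sqrt (by linarith)]; ring⟩
    have hyπ : y < π := lt_of_pow_lt_pow_left₀ 2 pi_pos.le (by linarith)
    have hpos := three_mul_sin_sub_pos ⟨hy0, hyπ⟩
    have h1 := two_mul_deriv_S (-y ^ 2)
    have h2 := two_mul_deriv_deriv_S (-y ^ 2)
    have hsin := mul_S_neg_sq y
    rw [C_neg_sq] at h1
    have key : 4 * y ^ 5 * powerSum (derivCoeff (derivCoeff coeffS)) (-y ^ 2)
        = 3 * (sin y - y * cos y) - y ^ 2 * sin y := by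
      rw [← hsin]
      linear_combination (-2 * y ^ 3) * h2 - 3 * y * h1
    rw [← key] at hpos
    exact pos_of_mul_pos_right hpos (by positivity)

/-- `C' = S/2`, `S'(x) = (C(x) - S(x))/(2x)` for `x ≠ 0`, and `S'` is strictly
increasing on `(-π², ∞)`. -/
theorem stmt1 :
    (∀ x : ℝ, deriv C x = S x / 2) ∧
    (∀ x : ℝ, x ≠ 0 → deriv S x = (C x - S x) / (2 * x)) ∧
    StrictMonoOn (deriv S) (Set.Ioi (-π ^ 2)) := by
  refine ⟨fun x => (hasDerivAt_C x).deriv, fun x hx => ?_, ?_⟩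
  · rw [eq_div_iff (mul_ne_zero two_ne_zero hx), mul_comm, two_mul_deriv_S]
  · refine strictMonoOn_of_deriv_pos (convex_Ioi _)
      (fun x _ => (hasDerivAt_deriv_S x).continuousAt.continuousWithinAt) fun x hx => ?_
    rw [interior_Ioi] at hx
    rw [(hasDerivAt_deriv_S x).deriv]
    exact deriv_deriv_S_pos hx
end

section
/- The image of the map \Pi_1 : SL_2(\mathbb{C}) \to SL_2(\mathbb{C}), \Pi_1(g) = \sigma(g)^{-1}\, g, is exactly the set \{ g \in SL_2(\mathbb{C}) : \sigma(g) = g^{-1} \}. In particular, every g \in SL_2(\mathbb{C}) whose entrywise complex conjugate equals its inverse can be written as g = \sigma(h)^{-1} h for some h \in SL_2(\mathbb{C}). -/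
/-- The entrywise complex conjugation `σ` of `SL₂(ℂ)` (fixing `SL₂(ℝ)`), at the matrix level. -/
def sigmaConj (g : Matrix (Fin 2) (Fin 2) ℂ) : Matrix (Fin 2) (Fin 2) ℂ :=
  g.map (starRingEnd ℂ)

/-- `Π₁(g) = σ(g)⁻¹ g`. -/
noncomputable def Pi1 (g : Matrix (Fin 2) (Fin 2) ℂ) : Matrix (Fin 2) (Fin 2) ℂ :=
  (sigmaConj g)⁻¹ * g

theorem sigmaConj_mul (g h : Matrix (Fin 2) (Fin 2) ℂ) :
    sigmaConj (g * h) = sigmaConj g * sigmaConj h :=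
  Matrix.map_mul

theorem sigmaConj_sigmaConj (g : Matrix (Fin 2) (Fin 2) ℂ) : sigmaConj (sigmaConj g) = g := by
  ext i j
  simp [sigmaConj]

theorem det_sigmaConj (g : Matrix (Fin 2) (Fin 2) ℂ) :
    (sigmaConj g).det = starRingEnd ℂ g.det :=
  ((starRingEnd ℂ).map_det g).symm

theorem sigmaConj_inv {g : Matrix (Fin 2) (Fin 2) ℂ} (hg : g.det = 1) :
    sigmaConj g⁻¹ = (sigmaConj g)⁻¹ := by
  symm
  apply Matrix.inv_eq_left_inv
  rw [← sigmaConj_mul, Matrix.nonsing_inv_mul g (by simp [hg])]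
  simp [sigmaConj]

theorem det_Pi1 {g : Matrix (Fin 2) (Fin 2) ℂ} (hg : g.det = 1) : (Pi1 g).det = 1 := by
  simp [Pi1, Matrix.det_nonsing_inv, det_sigmaConj, hg]

theorem sigmaConj_Pi1 {g : Matrix (Fin 2) (Fin 2) ℂ} (hg : g.det = 1) :
    sigmaConj (Pi1 g) = (Pi1 g)⁻¹ := by
  have hs : (sigmaConj g).det = 1 := by simp [det_sigmaConj, hg]
  rw [Pi1, sigmaConj_mul, sigmaConj_inv hs, sigmaConj_sigmaConj, Matrix.mul_inv_rev,
    Matrix.nonsing_inv_nonsing_inv _ (by simp [hs])]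

theorem eq_Pi1_of_sigmaConj_mul_eq {g h : Matrix (Fin 2) (Fin 2) ℂ} (hh : h.det = 1)
    (e : sigmaConj h * g = h) : g = Pi1 h := by
  have hs : (sigmaConj h).det = 1 := by simp [det_sigmaConj, hh]
  calc g = (sigmaConj h)⁻¹ * (sigmaConj h * g) :=
        (Matrix.nonsing_inv_mul_cancel_left _ _ (by simp [hs])).symm
    _ = Pi1 h := by rw [e, Pi1]

/-- Hilbert 90 for `SL₂`: up to a real diagonal factor fixing the determinant, a solution is
`1 + g` if `tr g ≠ -2`, and `i (1 - g)` otherwise. -/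
theorem exists_eq_Pi1 {g : Matrix (Fin 2) (Fin 2) ℂ} (hg : g.det = 1)
    (hs : sigmaConj g = g⁻¹) : ∃ h : Matrix (Fin 2) (Fin 2) ℂ, h.det = 1 ∧ g = Pi1 h := by
  rw [Matrix.inv_def, hg, Ring.inverse_one, one_smul] at hs
  obtain ⟨a, b, c, d, rfl⟩ : ∃ a b c d, g = !![a, b; c, d] := ⟨_, _, _, _, Matrix.eta_fin_two g⟩
  rw [Matrix.adjugate_fin_two_of] at hs
  have ha : starRingEnd ℂ a = d := congrFun (congrFun hs 0) 0
  have hb : starRingEnd ℂ b = -b := congrFun (congrFun hs 0) 1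
  have hc : starRingEnd ℂ c = -c := congrFun (congrFun hs 1) 0
  have hd : starRingEnd ℂ d = a := congrFun (congrFun hs 1) 1
  rw [Matrix.det_fin_two_of] at hg
  by_cases ht : 2 + a + d = 0
  · refine ⟨!![-Complex.I * (1 - a) / 4, Complex.I * b / 4; -Complex.I * c, Complex.I * (1 - d)],
      ?_, eq_Pi1_of_sigmaConj_mul_eq ?_ ?_⟩
    iterate 2
      rw [Matrix.det_fin_two_of]
      linear_combination (-(1 - a) * (1 - d) / 4 + b * c / 4) * Complex.I_sq + hg / 4 - ht / 4
    ext i j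
    fin_cases i <;> fin_cases j <;>
      simp [sigmaConj, Matrix.mul_apply, Fin.sum_univ_two, ha, hb, hc, hd, Complex.conj_ofNat]
    · linear_combination -Complex.I / 4 * hg
    · ring
    · ring
    · linear_combination Complex.I * hg
  · have ht' : 2 + d + a ≠ 0 := by rwa [add_right_comm]
    refine ⟨!![(1 + a) / (2 + a + d), b / (2 + a + d); c, 1 + d],
      ?_, eq_Pi1_of_sigmaConj_mul_eq ?_ ?_⟩
    iterate 2
      rw [Matrix.det_fin_two_of]
      field_simp
      linear_combination hg
    ext i j
    fin_cases i <;> fin_cases j <;>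
      simp [sigmaConj, Matrix.mul_apply, Fin.sum_univ_two, ha, hb, hc, hd, Complex.conj_ofNat, add_right_comm 2 d a]
    · field_simp
      linear_combination hg
    · field_simp
      ring
    · ring
    · linear_combination hg

/-- The image of `Π₁ : SL₂(ℂ) → SL₂(ℂ)`, `Π₁(g) = σ(g)⁻¹ g`, is exactly
`{ g ∈ SL₂(ℂ) : σ(g) = g⁻¹ }`. -/
theorem stmt6 :
    {h : Matrix (Fin 2) (Fin 2) ℂ |
        ∃ g : Matrix (Fin 2) (Fin 2) ℂ, g.det = 1 ∧ h = Pi1 g} =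
      {g : Matrix (Fin 2) (Fin 2) ℂ | g.det = 1 ∧ sigmaConj g = g⁻¹} := by
  ext h
  constructor
  · rintro ⟨g, hg, rfl⟩
    exact ⟨det_Pi1 hg, sigmaConj_Pi1 hg⟩
  · rintro ⟨hh, hs⟩
    exact exists_eq_Pi1 hh hs
end

section
/- The map (u,a) \mapsto \big( C(x) - 2uS(x),\; C(x) + 2uS(x) \big), where x := 4u^2 - 4a^2, is a bijection from the set \{ (u,a) \in \mathbb{R}^2 : a \ge 0,\ 4u^2 - 4a^2 \ge -\pi^2/4 \} onto the set \{ (s,t) \in \mathbb{R}^2 : s t \le 1 \text{ and } s + t \ge 0 \}. -/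
open Real

theorem C_sq (y : ℝ) : C (y ^ 2) = cosh y := by
  rw [C, ← (Real.hasSum_cosh y).tsum_eq]
  simp only [pow_mul]

theorem mul_S_sq (y : ℝ) : y * S (y ^ 2) = sinh y := by
  rw [S, ← (Real.hasSum_sinh y).tsum_eq, ← tsum_mul_left]
  refine tsum_congr fun n => ?_
  rw [pow_succ y (2 * n), pow_mul]
  ring

theorem S_zero : S 0 = 1 := by
  rw [S, tsum_eq_single 0 fun n hn => by simp [hn]]
  simp

theorem exists_eq_sq_or_eq_neg_sq {x : ℝ} (hx : -(π ^ 2) / 4 ≤ x) :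
    (∃ y, 0 ≤ y ∧ x = y ^ 2) ∨ ∃ y, 0 < y ∧ y ≤ π / 2 ∧ x = -y ^ 2 := by
  rcases le_or_gt 0 x with h | h
  · exact .inl ⟨√x, sqrt_nonneg x, (sq_sqrt h).symm⟩
  · refine .inr ⟨√(-x), sqrt_pos.2 (by linarith), ?_, ?_⟩
    · rw [sqrt_le_left (by positivity)]
      linarith
    · rw [sq_sqrt (by linarith), neg_neg]

theorem C_nonneg {x : ℝ} (hx : -(π ^ 2) / 4 ≤ x) : 0 ≤ C x := by
  rcases exists_eq_sq_or_eq_neg_sq hx with ⟨y, -, rfl⟩ | ⟨y, hy, hyπ, rfl⟩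
  · rw [C_sq]
    exact (cosh_pos y).le
  · rw [C_neg_sq]
    exact cos_nonneg_of_mem_Icc ⟨by linarith, hyπ⟩

theorem S_pos {x : ℝ} (hx : -(π ^ 2) / 4 ≤ x) : 0 < S x := by
  rcases exists_eq_sq_or_eq_neg_sq hx with ⟨y, hy, rfl⟩ | ⟨y, hy, hyπ, rfl⟩
  · rcases hy.eq_or_lt with rfl | hy
    · simp [S_zero]
    · refine pos_of_mul_pos_right ?_ hy.le
      rw [mul_S_sq]
      exact sinh_pos_iff.2 hy
  · refine pos_of_mul_pos_right ?_ hy.le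
    rw [mul_S_neg_sq]
    exact sin_pos_of_pos_of_lt_pi hy (by linarith)

theorem C_sq_eq {x : ℝ} (hx : -(π ^ 2) / 4 ≤ x) : C x ^ 2 = 1 + x * S x ^ 2 := by
  rcases exists_eq_sq_or_eq_neg_sq hx with ⟨y, -, rfl⟩ | ⟨y, -, -, rfl⟩
  · rw [← mul_pow, mul_S_sq, C_sq, cosh_sq, add_comm]
  · rw [neg_mul, ← mul_pow, mul_S_neg_sq, C_neg_sq, cos_sq', sub_eq_add_neg]

theorem C_injOn : Set.InjOn C (Set.Ici (-(π ^ 2) / 4)) := by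
  have cos_lt_cosh {y z : ℝ} (hz : 0 < z) (hzπ : z ≤ π / 2) : cos z < cosh y := by
    have := cos_lt_cos_of_nonneg_of_le_pi_div_two le_rfl hzπ hz
    rw [cos_zero] at this
    exact this.trans_le (one_le_cosh y)
  intro x hx x' hx' h
  rcases exists_eq_sq_or_eq_neg_sq hx with ⟨y, hy, rfl⟩ | ⟨y, hy, hyπ, rfl⟩ <;>
  rcases exists_eq_sq_or_eq_neg_sq hx' with ⟨z, hz, rfl⟩ | ⟨z, hz, hzπ, rfl⟩ <;>
  simp only [C_sq, C_neg_sq] at h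
  · rw [cosh_strictMonoOn.injOn hy hz h]
  · exact absurd h (cos_lt_cosh hz hzπ).ne'
  · exact absurd h (cos_lt_cosh hy hyπ).ne
  · rw [injOn_cos ⟨hy.le, by linarith⟩ ⟨hz.le, by linarith⟩ h]

theorem exists_C_eq {c : ℝ} (hc : 0 ≤ c) : ∃ x, -(π ^ 2) / 4 ≤ x ∧ C x = c := by
  rcases le_total c 1 with h | h
  · refine ⟨-arccos c ^ 2, ?_, by rw [C_neg_sq, cos_arccos (by linarith) h]⟩
    nlinarith [arccos_nonneg c, arccos_le_pi_div_two.2 hc]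
  · exact ⟨arcosh c ^ 2, by nlinarith [sq_nonneg π, sq_nonneg (arcosh c)],
      by rw [C_sq, cosh_arcosh h]⟩

/-- The map `(u,a) ↦ (C(x) - 2uS(x), C(x) + 2uS(x))`, `x = 4u² - 4a²`, is a bijection from
`{(u,a) : a ≥ 0, 4u² - 4a² ≥ -π²/4}` onto `{(s,t) : st ≤ 1, s + t ≥ 0}`. -/
theorem stmt11 :
    Set.BijOn
      (fun p : ℝ × ℝ =>
        (C (4 * p.1 ^ 2 - 4 * p.2 ^ 2) - 2 * p.1 * S (4 * p.1 ^ 2 - 4 * p.2 ^ 2),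
         C (4 * p.1 ^ 2 - 4 * p.2 ^ 2) + 2 * p.1 * S (4 * p.1 ^ 2 - 4 * p.2 ^ 2)))
      {p : ℝ × ℝ | 0 ≤ p.2 ∧ 4 * p.1 ^ 2 - 4 * p.2 ^ 2 ≥ -(π ^ 2) / 4}
      {q : ℝ × ℝ | q.1 * q.2 ≤ 1 ∧ 0 ≤ q.1 + q.2} := by
  refine ⟨?_, ?_, ?_⟩
  · rintro ⟨u, a⟩ ⟨-, hx⟩
    dsimp only at hx ⊢
    have hC := C_nonneg hx
    have hCS := C_sq_eq hx
    set x := 4 * u ^ 2 - 4 * a ^ 2 with hxdef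
    refine ⟨?_, by dsimp only; linarith⟩
    have : (C x - 2 * u * S x) * (C x + 2 * u * S x) = 1 - (2 * a * S x) ^ 2 := by
      linear_combination hCS + S x ^ 2 * hxdef
    dsimp only
    nlinarith [sq_nonneg (2 * a * S x)]
  · rintro ⟨u, a⟩ ⟨ha, hx⟩ ⟨v, b⟩ ⟨hb, hy⟩ h
    dsimp only at ha hx hb hy h
    obtain ⟨h₁, h₂⟩ := Prod.mk.inj h
    have hxy := C_injOn hx hy (by linarith)
    have hS := S_pos hx
    rw [← hxy] at h₁ h₂
    have huv : u = v := mul_right_cancel₀ hS.ne' (by linarith)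
    subst huv
    have hab : a = b := (sq_eq_sq₀ ha hb).1 (by linarith)
    rw [hab]
  · rintro ⟨s, t⟩ ⟨hst, hs⟩
    dsimp only at hst hs
    obtain ⟨x, hx, hCx⟩ := exists_C_eq (c := (s + t) / 2) (by linarith)
    have hS := S_pos hx
    have hCS := C_sq_eq hx
    have hxeq : 4 * ((t - s) / (4 * S x)) ^ 2 - 4 * (√(1 - s * t) / (2 * S x)) ^ 2 = x := by
      rw [div_pow, div_pow, sq_sqrt (by linarith)]
      rw [hCx] at hCS
      field_simp
      linear_combination 16 * hCS
    refine ⟨((t - s) / (4 * S x), √(1 - s * t) / (2 * S x)), ⟨by positivity, ?_⟩, ?_⟩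
    · dsimp only
      rwa [hxeq]
    · have hu : 2 * ((t - s) / (4 * S x)) * S x = (t - s) / 2 := by
        field_simp
        ring
      dsimp only
      rw [hxeq, hu, hCx]
      ext <;> dsimp only <;> ring
end
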